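/- Let X be a smooth 4-manifold with almost complex structure 𝔍 and splitting (L₁,L₂) of 𝔍, and let M ⊂ X be a hypersurface. For any local 2-forms (ω,φ) spanning (L₁,L₂) on an open set Ũ ⊂ X, the pullbacks of ω and φ to M ∩ Ũ are linearly independent at every point; hence adapted local coframings η = (η₁,η₂,η₃) with ω|_M = η₂∧η₁, φ|_M = η₂∧η₃ exist, and the line subbundles P₁ = {η₁,η₂}^⊥ and P₂ = {η₂,η₃}^⊥ of TM are independent of the choice of spanning forms and adapted coframing. If M is nondegenerate, i.e. D = P₁ ⊕ P₂ is a contact plane field, then (P₁,P₂) is a path geometry on M. -/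

import Mathlib

open scoped ContDiff

/-- The model of the `4`-manifold chart. -/
abbrev E4 : Type := Fin 4 → ℝ

/-- The model of the hypersurface chart. -/
abbrev E3 : Type := Fin 3 → ℝ

/-- The space in which `2`-forms on `E4` live (antisymmetric continuous bilinear
forms). -/
abbrev Form2 : Type := E4 →L[ℝ] (E4 →L[ℝ] ℝ)

/-- The real part of a complex-valued `2`-form on `E4`. -/
noncomputable def reB (α : E4 →L[ℝ] (E4 →L[ℝ] ℂ)) : Form2 :=
  (ContinuousLinearMap.compL ℝ E4 ℂ ℝ Complex.reCLM).comp α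

/-- The imaginary part of a complex-valued `2`-form on `E4`. -/
noncomputable def imB (α : E4 →L[ℝ] (E4 →L[ℝ] ℂ)) : Form2 :=
  (ContinuousLinearMap.compL ℝ E4 ℂ ℝ Complex.imCLM).comp α

/-- The fibre at `q` of the line field induced on the hypersurface `u` by a line
bundle `L` of `2`-forms: the common kernel of the pullbacks of the forms in `L`. -/
def Pind (L : E4 → Submodule ℝ Form2) (u : E3 → E4) (q : E3) : Set E3 :=
  {v | ∀ β ∈ L (u q), ∀ w, β (fderiv ℝ u q v) (fderiv ℝ u q w) = 0}

/-- The hypersurface `u` is nondegenerate: the plane field spanned by the two induced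
line fields is a contact plane field (the Lie bracket of local smooth spanning vector
fields does not lie in the plane field). -/
def Nondeg (L₁ L₂ : E4 → Submodule ℝ Form2) (u : E3 → E4) (V : Set E3) : Prop :=
  ∀ q ∈ V, ∃ r > (0 : ℝ), Metric.ball q r ⊆ V ∧
    ∃ X Y : E3 → E3,
      ContDiffOn ℝ ∞ X (Metric.ball q r) ∧ ContDiffOn ℝ ∞ Y (Metric.ball q r) ∧
      ∀ q' ∈ Metric.ball q r,
        X q' ≠ 0 ∧ Y q' ≠ 0 ∧
        Pind L₁ u q' = ↑(Submodule.span ℝ {X q'}) ∧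
        Pind L₂ u q' = ↑(Submodule.span ℝ {Y q'}) ∧
        VectorField.lieBracket ℝ X Y q' ∉ Submodule.span ℝ {X q', Y q'}

/-- A complex structure on `E4` does not preserve a hyperplane. -/
lemma exists_complexStructure_notMem_range (J : E4 →L[ℝ] E4) (hJ : ∀ v, J (J v) = -v)
    (T : E3 →L[ℝ] E4) (hT : Function.Injective T) :
    ∃ t, J (T t) ∉ LinearMap.range T.toLinearMap := by
  by_contra! h
  let e := LinearEquiv.ofInjective T.toLinearMap hT
  let R : E3 →ₗ[ℝ] E3 :=
    e.symm.toLinearMap ∘ₗ (J.toLinearMap ∘ₗ T.toLinearMap).codRestrict _ h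
  have hR : ∀ t, T (R t) = J (T t) := fun t =>
    congrArg Subtype.val (e.apply_symm_apply ⟨J (T t), h t⟩)
  have hRR : R * R = -1 := by
    refine LinearMap.ext fun t => hT ?_
    simp [hR, hJ]
  have hd : LinearMap.det R * LinearMap.det R = (-1) ^ 3 := by
    have hneg : (-1 : E3 →ₗ[ℝ] E3) = (-1 : ℝ) • 1 := LinearMap.ext fun t => by simp
    rw [← map_mul, hRR, hneg, LinearMap.det_smul]
    simp
  nlinarith [mul_self_nonneg (LinearMap.det R)]

/-- A `(2,0)`-form whose real part vanishes on a hyperplane is zero. -/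
lemma eq_zero_of_re_pullback_eq_zero (J : E4 →L[ℝ] E4) (hJ : ∀ v, J (J v) = -v)
    (T : E3 →L[ℝ] E4) (hT : Function.Injective T) (α : E4 →L[ℝ] (E4 →L[ℝ] ℂ))
    (hα : ∀ v w, α v w = -(α w v)) (hJα : ∀ v w, α (J v) w = Complex.I * α v w)
    (hre : ∀ v w, (α (T v) (T w)).re = 0) : α = 0 := by
  have hJα' : ∀ v w, α v (J w) = Complex.I * α v w := fun v w => by
    rw [hα, hJα, hα v w]; ring
  have hself : ∀ v, α v v = 0 := fun v => self_eq_neg.mp (hα v v)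
  have hJinj : Function.Injective J := fun v w h => by
    simpa [hJ] using congrArg J h
  set H := LinearMap.range T.toLinearMap with hHdef
  set K := H ⊓ H.map J.toLinearMap with hKdef
  have hreH : ∀ v ∈ H, ∀ w ∈ H, (α v w).re = 0 := by
    rintro _ ⟨v, rfl⟩ _ ⟨w, rfl⟩
    exact hre v w
  have hH : Module.finrank ℝ H = 3 := by
    rw [hHdef, LinearMap.finrank_range_of_inj hT]; simp
  have hJH : Module.finrank ℝ (H.map J.toLinearMap) = 3 := by
    exact (LinearEquiv.finrank_eq
      (Submodule.equivMapOfInjective J.toLinearMap hJinj H)).symm.trans hH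
  obtain ⟨t, ht⟩ := exists_complexStructure_notMem_range J hJ T hT
  have hsup : H ⊔ H.map J.toLinearMap = ⊤ := by
    have hlt : H < H ⊔ H.map J.toLinearMap := by
      refine lt_of_le_of_ne le_sup_left fun h => ht ?_
      rw [← hHdef, h]
      exact Submodule.mem_sup_right ⟨T t, ⟨t, rfl⟩, rfl⟩
    apply Submodule.eq_top_of_finrank_eq
    have h1 := Submodule.finrank_lt_finrank_of_lt hlt
    have h2 := Submodule.finrank_le (H ⊔ H.map J.toLinearMap)
    have h3 : Module.finrank ℝ E4 = 4 := by simp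
    omega
  have hK : Module.finrank ℝ K = 2 := by
    have h1 := Submodule.finrank_sup_add_finrank_inf_eq H (H.map J.toLinearMap)
    have h3 : Module.finrank ℝ E4 = 4 := by simp
    rw [hsup, finrank_top, hH, hJH, h3, ← hKdef] at h1
    omega
  have hKH : ∀ v ∈ K, ∀ w ∈ H, α v w = 0 := by
    rintro v ⟨hv, v', hv', rfl⟩ w hw
    have h1 := hreH _ hv w hw
    have h2 := hreH _ hv' w hw
    change (α (J v') w).re = 0 at h1
    change α (J v') w = 0
    rw [hJα] at h1 ⊢
    have h3 : (α v' w).im = 0 := by simpa using h1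
    rw [Complex.ext (z := α v' w) (w := 0) h2 h3, mul_zero]
  have hHH : ∀ v ∈ H, ∀ w ∈ H, α v w = 0 := by
    intro v hv w hw
    by_cases hvK : v ∈ K
    · exact hKH v hvK w hw
    have hle : K ⊔ ℝ ∙ v ≤ H :=
      sup_le inf_le_left ((Submodule.span_singleton_le_iff_mem _ _).2 hv)
    have hlt : K < K ⊔ ℝ ∙ v := by
      refine lt_of_le_of_ne le_sup_left fun h => hvK ?_
      rw [h]
      exact Submodule.mem_sup_right (Submodule.mem_span_singleton_self v)
    have h1 := Submodule.finrank_lt_finrank_of_lt hlt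
    have heq : K ⊔ ℝ ∙ v = H := Submodule.eq_of_le_of_finrank_le hle (by omega)
    rw [← heq] at hw
    obtain ⟨k, hk, _, hz, rfl⟩ := Submodule.mem_sup.1 hw
    obtain ⟨c, rfl⟩ := Submodule.mem_span_singleton.1 hz
    rw [map_add, map_smul, hself, hα v k, hKH k hk v hv]
    simp
  ext1 v
  ext1 w
  have hv : v ∈ H ⊔ H.map J.toLinearMap := hsup ▸ Submodule.mem_top
  have hw : w ∈ H ⊔ H.map J.toLinearMap := hsup ▸ Submodule.mem_top
  obtain ⟨v₁, hv₁, _, ⟨v₂, hv₂, rfl⟩, rfl⟩ := Submodule.mem_sup.1 hv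
  obtain ⟨w₁, hw₁, _, ⟨w₂, hw₂, rfl⟩, rfl⟩ := Submodule.mem_sup.1 hw
  simp [hJα, hJα', hHH v₁ hv₁ w₁ hw₁, hHH v₁ hv₁ w₂ hw₂, hHH v₂ hv₂ w₁ hw₁,
    hHH v₂ hv₂ w₂ hw₂]

/-- Forms spanning the two lines of a splitting have linearly independent pullbacks to a
hyperplane. -/
lemma pullback_independent (J : E4 →L[ℝ] E4) (hJ : ∀ v, J (J v) = -v)
    (T : E3 →L[ℝ] E4) (hT : Function.Injective T) (α : E4 →L[ℝ] (E4 →L[ℝ] ℂ))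
    (hα : ∀ v w, α v w = -(α w v)) (hJα : ∀ v w, α (J v) w = Complex.I * α v w)
    {φ ψ : Form2} (hφ : φ ≠ 0) (hψ : ψ ≠ 0)
    (hsup : Submodule.span ℝ {φ} ⊔ Submodule.span ℝ {ψ} = Submodule.span ℝ {reB α, imB α})
    (hinf : Submodule.span ℝ {φ} ⊓ Submodule.span ℝ {ψ} = ⊥) (a b : ℝ)
    (h : ∀ v w, a * φ (T v) (T w) + b * ψ (T v) (T w) = 0) : a = 0 ∧ b = 0 := by
  have hmφ : ∀ c : ℝ, c • φ ∈ Submodule.span ℝ {φ} := fun c =>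
    Submodule.smul_mem _ _ (Submodule.mem_span_singleton_self φ)
  have hmψ : ∀ c : ℝ, c • ψ ∈ Submodule.span ℝ {ψ} := fun c =>
    Submodule.smul_mem _ _ (Submodule.mem_span_singleton_self ψ)
  have hmem : a • φ + b • ψ ∈ Submodule.span ℝ {reB α, imB α} :=
    hsup ▸ Submodule.add_mem_sup (hmφ a) (hmψ b)
  obtain ⟨x, y, hxy⟩ := Submodule.mem_span_pair.1 hmem
  have hval : ∀ v w, ((⟨x, -y⟩ : ℂ) * α v w).re = a * φ v w + b * ψ v w := by
    intro v w
    have := congrArg (fun β : Form2 => β v w) hxy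
    simpa [reB, imB] using this
  have hz : (⟨x, -y⟩ : ℂ) • α = 0 := by
    refine eq_zero_of_re_pullback_eq_zero J hJ T hT _ (fun v w => ?_) (fun v w => ?_)
      (fun v w => ?_)
    · simp [hα v w]
    · simp only [FunLike.coe_smul, Pi.smul_apply, smul_eq_mul, hJα]
      ring
    · simpa using (hval (T v) (T w)).trans (h v w)
  have hsum : ∀ v w, a * φ v w + b * ψ v w = 0 := fun v w => by
    have h1 : (⟨x, -y⟩ : ℂ) * α v w = 0 := by
      simpa using congrArg (fun β : E4 →L[ℝ] (E4 →L[ℝ] ℂ) => β v w) hz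
    simpa [h1] using (hval v w).symm
  have heq : a • φ = (-b) • ψ := by
    ext1 v
    ext1 w
    simpa using eq_neg_of_add_eq_zero_left (hsum v w)
  have ha : a • φ = 0 := by
    have : a • φ ∈ Submodule.span ℝ {φ} ⊓ Submodule.span ℝ {ψ} := ⟨hmφ a, heq ▸ hmψ (-b)⟩
    rwa [hinf, Submodule.mem_bot] at this
  have hb : -b = 0 := (smul_eq_zero_iff_left (M := Form2) hψ).1 (heq.symm.trans ha)
  exact ⟨(smul_eq_zero_iff_left (M := Form2) hφ).1 ha, neg_eq_zero.1 hb⟩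

lemma antisymm_of_mem_span (α : E4 →L[ℝ] (E4 →L[ℝ] ℂ)) (hα : ∀ v w, α v w = -(α w v))
    {β : Form2} (hβ : β ∈ Submodule.span ℝ {reB α, imB α}) (v w : E4) :
    β v w = -(β w v) := by
  obtain ⟨x, y, rfl⟩ := Submodule.mem_span_pair.1 hβ
  simp [reB, imB, hα v w]
  ring

/-- The covector on `E3` with the given coefficients. -/
noncomputable def covector (x y z : ℝ) : E3 →L[ℝ] ℝ :=
  x • ContinuousLinearMap.proj 0 + y • ContinuousLinearMap.proj 1 +
    z • ContinuousLinearMap.proj 2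

lemma covector_apply (x y z : ℝ) (v : E3) :
    covector x y z v = x * v 0 + y * v 1 + z * v 2 := by
  simp [covector]

lemma ContDiffOn.covector {x y z : E3 → ℝ} {W : Set E3} (hx : ContDiffOn ℝ ∞ x W)
    (hy : ContDiffOn ℝ ∞ y W) (hz : ContDiffOn ℝ ∞ z W) :
    ContDiffOn ℝ ∞ (fun q => _root_.covector (x q) (y q) (z q)) W :=
  ((hx.smul contDiffOn_const).add (hy.smul contDiffOn_const)).add (hz.smul contDiffOn_const)

/-- The value of the pullback of `β` along `T` on the `i`-th and `j`-th coordinate vectors. -/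
noncomputable def pullbackCoeff (β : Form2) (T : E3 →L[ℝ] E4) (i j : Fin 3) : ℝ :=
  β (T (Pi.single i 1)) (T (Pi.single j 1))

lemma pullback_eq_coeff (β : Form2) (hβ : ∀ v w, β v w = -(β w v)) (T : E3 →L[ℝ] E4)
    (v w : E3) :
    β (T v) (T w) = pullbackCoeff β T 1 2 * (v 1 * w 2 - v 2 * w 1) +
      pullbackCoeff β T 2 0 * (v 2 * w 0 - v 0 * w 2) +
      pullbackCoeff β T 0 1 * (v 0 * w 1 - v 1 * w 0) := by
  have hself : ∀ v, β v v = 0 := fun v => self_eq_neg.mp (hβ v v)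
  have hexp : ∀ v : E3, T v = v 0 • T (Pi.single 0 1) + v 1 • T (Pi.single 1 1) +
      v 2 • T (Pi.single 2 1) := by
    intro v
    rw [← map_smul, ← map_smul, ← map_smul, ← map_add, ← map_add]
    congr 1
    ext i
    fin_cases i <;> simp
  rw [hexp v, hexp w]
  simp only [map_add, map_smul, FunLike.coe_add, FunLike.coe_smul, Pi.add_apply, Pi.smul_apply,
    smul_eq_mul, hself, pullbackCoeff]
  rw [hβ (T (Pi.single 1 1)) (T (Pi.single 0 1)), hβ (T (Pi.single 0 1)) (T (Pi.single 2 1)),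
    hβ (T (Pi.single 2 1)) (T (Pi.single 1 1))]
  ring

/-- If the pairs `η₂ ∧ η₁` and `η₂ ∧ η₃` are independent, then so are the three covectors. -/
lemma linearIndependent_of_wedge {η₁ η₂ η₃ : E3 →L[ℝ] ℝ}
    (h : ∀ a b : ℝ, (∀ v w, a * (η₂ v * η₁ w - η₂ w * η₁ v) +
      b * (η₂ v * η₃ w - η₂ w * η₃ v) = 0) → a = 0 ∧ b = 0) :
    LinearIndependent ℝ ![η₁, η₂, η₃] := by
  rw [Fintype.linearIndependent_iff]
  intro g hg
  have hg' : ∀ v, g 0 * η₁ v + g 1 * η₂ v + g 2 * η₃ v = 0 := fun v => by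
    simpa [Fin.sum_univ_three] using congrArg (fun η : E3 →L[ℝ] ℝ => η v) hg
  obtain ⟨h0, h2⟩ := h (g 0) (g 2) fun v w => by
    linear_combination η₂ v * hg' w - η₂ w * hg' v
  have h1 : g 1 = 0 := by
    by_contra hne
    have hη₂ : ∀ v, η₂ v = 0 := fun v => by
      simpa [h0, h2, hne] using hg' v
    exact one_ne_zero (h 1 1 fun v w => by simp [hη₂]).1
  intro i
  fin_cases i <;> assumption

/-- The cross product of two independent vectors has nonzero squared length. -/
lemma cross_sq_ne_zero {a₀ a₁ a₂ c₀ c₁ c₂ : ℝ}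
    (h : ∀ a b : ℝ, a * a₀ + b * c₀ = 0 → a * a₁ + b * c₁ = 0 → a * a₂ + b * c₂ = 0 →
      a = 0 ∧ b = 0) :
    (a₁ * c₂ - a₂ * c₁) ^ 2 + (a₂ * c₀ - a₀ * c₂) ^ 2 + (a₀ * c₁ - a₁ * c₀) ^ 2 ≠ 0 := by
  intro hn
  have h0 : a₁ * c₂ - a₂ * c₁ = 0 := by
    apply pow_eq_zero_iff two_ne_zero |>.1; nlinarith [sq_nonneg (a₁ * c₂ - a₂ * c₁),
      sq_nonneg (a₂ * c₀ - a₀ * c₂), sq_nonneg (a₀ * c₁ - a₁ * c₀)]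
  have h1 : a₂ * c₀ - a₀ * c₂ = 0 := by
    apply pow_eq_zero_iff two_ne_zero |>.1; nlinarith [sq_nonneg (a₁ * c₂ - a₂ * c₁),
      sq_nonneg (a₂ * c₀ - a₀ * c₂), sq_nonneg (a₀ * c₁ - a₁ * c₀)]
  have h2 : a₀ * c₁ - a₁ * c₀ = 0 := by
    apply pow_eq_zero_iff two_ne_zero |>.1; nlinarith [sq_nonneg (a₁ * c₂ - a₂ * c₁),
      sq_nonneg (a₂ * c₀ - a₀ * c₂), sq_nonneg (a₀ * c₁ - a₁ * c₀)]
  obtain ⟨-, k0⟩ := h c₀ (-a₀) (by ring) (by linarith) (by linarith)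
  obtain ⟨-, k1⟩ := h c₁ (-a₁) (by linarith) (by ring) (by linarith)
  obtain ⟨-, k2⟩ := h c₂ (-a₂) (by linarith) (by linarith) (by ring)
  rw [neg_eq_zero] at k0 k1 k2
  exact one_ne_zero (h 1 0 (by simp [k0]) (by simp [k1]) (by simp [k2])).1

lemma contDiffOn_pullbackCoeff {V W : Set E3} (hV : IsOpen V) (hWV : W ⊆ V) {u : E3 → E4}
    (hu : ContDiffOn ℝ ∞ u V) {Ut : Set E4} (hWU : u '' W ⊆ Ut) {φ : E4 → Form2}
    (hφ : ContDiffOn ℝ ∞ φ Ut) (i j : Fin 3) :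
    ContDiffOn ℝ ∞ (fun q => pullbackCoeff (φ (u q)) (fderiv ℝ u q) i j) W := by
  have hdu : ContDiffOn ℝ ∞ (fderiv ℝ u) W :=
    (hu.fderiv_of_isOpen hV (by simp)).mono hWV
  have hφu : ContDiffOn ℝ ∞ (fun q => φ (u q)) W :=
    hφ.comp (hu.mono hWV) (Set.mapsTo_iff_image_subset.2 hWU)
  exact (hφu.clm_apply (hdu.clm_apply contDiffOn_const)).clm_apply
    (hdu.clm_apply contDiffOn_const)

/-- Smooth forms with independent pullbacks admit an adapted coframing. -/
lemma exists_adapted_coframing {V W : Set E3} (hV : IsOpen V) (hWV : W ⊆ V) {u : E3 → E4}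
    (hu : ContDiffOn ℝ ∞ u V) {Ut : Set E4} (hWU : u '' W ⊆ Ut) {φ ψ : E4 → Form2}
    (hφ : ContDiffOn ℝ ∞ φ Ut) (hψ : ContDiffOn ℝ ∞ ψ Ut)
    (hφa : ∀ p ∈ Ut, ∀ v w, φ p v w = -(φ p w v))
    (hψa : ∀ p ∈ Ut, ∀ v w, ψ p v w = -(ψ p w v))
    (hind : ∀ q ∈ W, ∀ a b : ℝ,
      (∀ v w, a * φ (u q) (fderiv ℝ u q v) (fderiv ℝ u q w) +
        b * ψ (u q) (fderiv ℝ u q v) (fderiv ℝ u q w) = 0) → a = 0 ∧ b = 0) :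
    ∃ η₁ η₂ η₃ : E3 → (E3 →L[ℝ] ℝ),
      ContDiffOn ℝ ∞ η₁ W ∧ ContDiffOn ℝ ∞ η₂ W ∧ ContDiffOn ℝ ∞ η₃ W ∧
      ∀ q ∈ W, LinearIndependent ℝ ![η₁ q, η₂ q, η₃ q] ∧
        (∀ v w, φ (u q) (fderiv ℝ u q v) (fderiv ℝ u q w) =
          η₂ q v * η₁ q w - η₂ q w * η₁ q v) ∧
        (∀ v w, ψ (u q) (fderiv ℝ u q v) (fderiv ℝ u q w) =
          η₂ q v * η₃ q w - η₂ q w * η₃ q v) := by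
  have hA := fun i j => contDiffOn_pullbackCoeff hV hWV hu hWU hφ i j
  have hC := fun i j => contDiffOn_pullbackCoeff hV hWV hu hWU hψ i j
  have hAe := fun q (hq : q ∈ W) =>
    pullback_eq_coeff (φ (u q)) (hφa _ (hWU ⟨q, hq, rfl⟩)) (fderiv ℝ u q)
  have hCe := fun q (hq : q ∈ W) =>
    pullback_eq_coeff (ψ (u q)) (hψa _ (hWU ⟨q, hq, rfl⟩)) (fderiv ℝ u q)
  set A : Fin 3 → Fin 3 → E3 → ℝ := fun i j q => pullbackCoeff (φ (u q)) (fderiv ℝ u q) i j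
  set C : Fin 3 → Fin 3 → E3 → ℝ := fun i j q => pullbackCoeff (ψ (u q)) (fderiv ℝ u q) i j
  change ∀ i j, ContDiffOn ℝ ∞ (A i j) W at hA
  change ∀ i j, ContDiffOn ℝ ∞ (C i j) W at hC
  change ∀ q, q ∈ W → ∀ v w : E3, φ (u q) (fderiv ℝ u q v) (fderiv ℝ u q w) =
    A 1 2 q * (v 1 * w 2 - v 2 * w 1) + A 2 0 q * (v 2 * w 0 - v 0 * w 2) +
      A 0 1 q * (v 0 * w 1 - v 1 * w 0) at hAe
  change ∀ q, q ∈ W → ∀ v w : E3, ψ (u q) (fderiv ℝ u q v) (fderiv ℝ u q w) =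
    C 1 2 q * (v 1 * w 2 - v 2 * w 1) + C 2 0 q * (v 2 * w 0 - v 0 * w 2) +
      C 0 1 q * (v 0 * w 1 - v 1 * w 0) at hCe
  generalize A 1 2 = a₀, A 2 0 = a₁, A 0 1 = a₂, hA 1 2 = ha₀, hA 2 0 = ha₁, hA 0 1 = ha₂,
    C 1 2 = c₀, C 2 0 = c₁, C 0 1 = c₂, hC 1 2 = hc₀, hC 2 0 = hc₁, hC 0 1 = hc₂ at hAe hCe
  let n₀ : E3 → ℝ := fun q => a₁ q * c₂ q - a₂ q * c₁ q
  let n₁ : E3 → ℝ := fun q => a₂ q * c₀ q - a₀ q * c₂ q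
  let n₂ : E3 → ℝ := fun q => a₀ q * c₁ q - a₁ q * c₀ q
  let n : E3 → ℝ := fun q => n₀ q ^ 2 + n₁ q ^ 2 + n₂ q ^ 2
  have hn₀ : ContDiffOn ℝ ∞ n₀ W := (ha₁.mul hc₂).sub (ha₂.mul hc₁)
  have hn₁ : ContDiffOn ℝ ∞ n₁ W := (ha₂.mul hc₀).sub (ha₀.mul hc₂)
  have hn₂ : ContDiffOn ℝ ∞ n₂ W := (ha₀.mul hc₁).sub (ha₁.mul hc₀)
  have hn : ContDiffOn ℝ ∞ n W := ((hn₀.pow 2).add (hn₁.pow 2)).add (hn₂.pow 2)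
  have hne : ∀ q ∈ W, n q ≠ 0 := fun q hq =>
    cross_sq_ne_zero fun a b e₀ e₁ e₂ => hind q hq a b fun v w => by
      rw [hAe q hq, hCe q hq]
      linear_combination (v 1 * w 2 - v 2 * w 1) * e₀ + (v 2 * w 0 - v 0 * w 2) * e₁ +
        (v 0 * w 1 - v 1 * w 0) * e₂
  let η : (E3 → ℝ) → (E3 → ℝ) → (E3 → ℝ) → E3 → (E3 →L[ℝ] ℝ) := fun b₀ b₁ b₂ q =>
    covector ((b₁ q * n₂ q - b₂ q * n₁ q) / n q) ((b₂ q * n₀ q - b₀ q * n₂ q) / n q)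
      ((b₀ q * n₁ q - b₁ q * n₀ q) / n q)
  have hη : ∀ {b₀ b₁ b₂ : E3 → ℝ}, ContDiffOn ℝ ∞ b₀ W → ContDiffOn ℝ ∞ b₁ W →
      ContDiffOn ℝ ∞ b₂ W → ContDiffOn ℝ ∞ (η b₀ b₁ b₂) W := fun h₀ h₁ h₂ =>
    ContDiffOn.covector (((h₁.mul hn₂).sub (h₂.mul hn₁)).div hn hne)
      (((h₂.mul hn₀).sub (h₀.mul hn₂)).div hn hne)
      (((h₀.mul hn₁).sub (h₁.mul hn₀)).div hn hne)
  have hwedge : ∀ b₀ b₁ b₂ : E3 → ℝ, ∀ q ∈ W,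
      b₀ q * n₀ q + b₁ q * n₁ q + b₂ q * n₂ q = 0 → ∀ v w : E3,
      b₀ q * (v 1 * w 2 - v 2 * w 1) + b₁ q * (v 2 * w 0 - v 0 * w 2) +
        b₂ q * (v 0 * w 1 - v 1 * w 0) =
      covector (n₀ q) (n₁ q) (n₂ q) v * η b₀ b₁ b₂ q w -
        covector (n₀ q) (n₁ q) (n₂ q) w * η b₀ b₁ b₂ q v := by
    intro b₀ b₁ b₂ q hq horth v w
    have hnq := hne q hq
    have hndef : n q = n₀ q ^ 2 + n₁ q ^ 2 + n₂ q ^ 2 := rfl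
    simp only [η, covector_apply]
    field_simp
    rw [hndef]
    linear_combination (n₀ q * (v 1 * w 2 - v 2 * w 1) + n₁ q * (v 2 * w 0 - v 0 * w 2) +
      n₂ q * (v 0 * w 1 - v 1 * w 0)) * horth
  have hφ' : ∀ q ∈ W, ∀ v w, φ (u q) (fderiv ℝ u q v) (fderiv ℝ u q w) =
      covector (n₀ q) (n₁ q) (n₂ q) v * η a₀ a₁ a₂ q w -
        covector (n₀ q) (n₁ q) (n₂ q) w * η a₀ a₁ a₂ q v := fun q hq v w => by
    rw [hAe q hq]
    exact hwedge a₀ a₁ a₂ q hq (by simp only [n₀, n₁, n₂]; ring) v w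
  have hψ' : ∀ q ∈ W, ∀ v w, ψ (u q) (fderiv ℝ u q v) (fderiv ℝ u q w) =
      covector (n₀ q) (n₁ q) (n₂ q) v * η c₀ c₁ c₂ q w -
        covector (n₀ q) (n₁ q) (n₂ q) w * η c₀ c₁ c₂ q v := fun q hq v w => by
    rw [hCe q hq]
    exact hwedge c₀ c₁ c₂ q hq (by simp only [n₀, n₁, n₂]; ring) v w
  refine ⟨η a₀ a₁ a₂, fun q => covector (n₀ q) (n₁ q) (n₂ q), η c₀ c₁ c₂, hη ha₀ ha₁ ha₂,
    ContDiffOn.covector hn₀ hn₁ hn₂, hη hc₀ hc₁ hc₂, fun q hq => ⟨?_, hφ' q hq, hψ' q hq⟩⟩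
  refine linearIndependent_of_wedge fun a b hab => hind q hq a b fun v w => ?_
  rw [hφ' q hq, hψ' q hq]
  exact hab v w

/-- The kernel of a decomposable `2`-form is the common kernel of its factors. -/
lemma setOf_eq_Pind {L : E4 → Submodule ℝ Form2} {u : E3 → E4} {q : E3} {φ : Form2}
    (hL : L (u q) = Submodule.span ℝ {φ}) {η ζ : E3 →L[ℝ] ℝ}
    (hηζ : LinearIndependent ℝ ![η, ζ])
    (h : ∀ v w, φ (fderiv ℝ u q v) (fderiv ℝ u q w) = η v * ζ w - η w * ζ v) :
    {v | η v = 0 ∧ ζ v = 0} = Pind L u q := by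
  ext v
  simp only [Pind, Set.mem_ofPred_eq, hL]
  constructor
  · rintro ⟨h₁, h₂⟩ β hβ w
    obtain ⟨c, rfl⟩ := Submodule.mem_span_singleton.1 hβ
    simp [h, h₁, h₂]
  · intro hv
    have hv' := hv φ (Submodule.mem_span_singleton_self φ)
    have := LinearIndependent.pair_iff.1 hηζ (-ζ v) (η v) (by
      ext1 w
      simp only [FunLike.coe_add, FunLike.coe_smul, Pi.add_apply, Pi.smul_apply, smul_eq_mul,
        FunLike.coe_zero, Pi.zero_apply]
      linear_combination (h v w).symm.trans (hv' w))
    exact ⟨this.2, neg_eq_zero.1 this.1⟩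

/-- The two line fields annihilated by an adapted coframing. -/
lemma setOf_eq_Pind_of_adapted {L₁ L₂ : E4 → Submodule ℝ Form2} {u : E3 → E4} {q : E3}
    {φ ψ : Form2} (hL₁ : L₁ (u q) = Submodule.span ℝ {φ})
    (hL₂ : L₂ (u q) = Submodule.span ℝ {ψ}) {η₁ η₂ η₃ : E3 →L[ℝ] ℝ}
    (hη : LinearIndependent ℝ ![η₁, η₂, η₃])
    (hφ : ∀ v w, φ (fderiv ℝ u q v) (fderiv ℝ u q w) = η₂ v * η₁ w - η₂ w * η₁ v)
    (hψ : ∀ v w, ψ (fderiv ℝ u q v) (fderiv ℝ u q w) = η₂ v * η₃ w - η₂ w * η₃ v) :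
    {v | η₁ v = 0 ∧ η₂ v = 0} = Pind L₁ u q ∧ {v | η₂ v = 0 ∧ η₃ v = 0} = Pind L₂ u q := by
  have h₂₁ : LinearIndependent ℝ ![η₂, η₁] := by
    convert hη.comp ![1, 0] (by decide) using 1
    ext i : 1
    fin_cases i <;> rfl
  have h₂₃ : LinearIndependent ℝ ![η₂, η₃] := by
    convert hη.comp ![1, 2] (by decide) using 1
    ext i : 1
    fin_cases i <;> rfl
  refine ⟨?_, setOf_eq_Pind hL₂ h₂₃ hψ⟩
  rw [← setOf_eq_Pind hL₁ h₂₁ hφ]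
  exact Set.ext fun v => and_comm

/-- A vector annihilated by a coframe is zero. -/
lemma eq_zero_of_coframe_eq_zero {η : Fin 3 → E3 →L[ℝ] ℝ} (hη : LinearIndependent ℝ η) {v : E3}
    (hv : ∀ i, η i v = 0) : v = 0 := by
  have hη' : LinearIndependent ℝ fun i => (η i : E3 →ₗ[ℝ] ℝ) :=
    hη.map' (ContinuousLinearMap.coeLM ℝ)
      (LinearMap.ker_eq_bot.2 ContinuousLinearMap.coe_injective)
  have hspan : Submodule.span ℝ (Set.range fun i => (η i : E3 →ₗ[ℝ] ℝ)) = ⊤ :=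
    hη'.span_eq_top_of_card_eq_finrank' (by
      have h : Module.finrank ℝ (Module.Dual ℝ E3) = 3 := by
        rw [Subspace.dual_finrank_eq]; simp
      exact (Fintype.card_fin 3).trans h.symm)
  refine (Module.forall_dual_apply_eq_zero_iff ℝ v).1 fun f => ?_
  have hf : f ∈ Submodule.span ℝ (Set.range fun i => (η i : E3 →ₗ[ℝ] ℝ)) :=
    hspan ▸ Submodule.mem_top
  induction hf using Submodule.span_induction with
  | mem _ h => obtain ⟨i, rfl⟩ := h; exact hv i
  | zero => rfl
  | add _ _ _ _ h₁ h₂ => simp [h₁, h₂]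
  | smul _ _ _ h => simp [h]

/-- let `X` be a smooth `4`-manifold (modelled on a chart, an open set
`S ⊆ ℝ⁴`) with almost complex structure `𝔍` and splitting `(L₁, L₂)` of `𝔍` (smooth
line bundles of `2`-forms with `L₁ ⊕ L₂ = Λ_𝔍`, the bundle spanned by real and
imaginary parts of nonzero `(2,0)`-forms), and let `M ⊆ X` be a hypersurface (an
embedded image `u : V → S` of an open set `V ⊆ ℝ³`).  Then: (1) for any local
`2`-forms `(ω, φ)` spanning `(L₁, L₂)`, their pullbacks to `M` are linearly
independent at every point; (2) adapted local coframings `η` with `ω|_M = η₂∧η₁`,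
`φ|_M = η₂∧η₃` exist; (3) for every choice of spanning forms and adapted coframing,
`{η₁,η₂}^⊥` and `{η₂,η₃}^⊥` equal the choice-independent line fields
`P₁ = Pind L₁`, `P₂ = Pind L₂`; and (4) if `M` is nondegenerate (`P₁ ⊕ P₂` a contact
plane field) then `(P₁, P₂)` is a path geometry on `M`: `P₁`, `P₂` are line fields
meeting trivially (which, by nondegeneracy, span a contact plane field). -/
theorem stmt12
    (S : Set E4) (hS : IsOpen S)
    (𝔍 : E4 → (E4 →L[ℝ] E4)) (h𝔍s : ContDiffOn ℝ ∞ 𝔍 S)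
    (h𝔍 : ∀ p ∈ S, ∀ v, 𝔍 p (𝔍 p v) = -v)
    (L₁ L₂ : E4 → Submodule ℝ Form2)
    (hsplit : ∀ p ∈ S, ∃ α : E4 →L[ℝ] (E4 →L[ℝ] ℂ),
      α ≠ 0 ∧ (∀ v w, α v w = -(α w v)) ∧
      (∀ v w, α (𝔍 p v) w = Complex.I * α v w) ∧
      L₁ p ⊔ L₂ p = Submodule.span ℝ {reB α, imB α} ∧ L₁ p ⊓ L₂ p = ⊥)
    (hline : ∀ p ∈ S, ∃ r > (0 : ℝ), Metric.ball p r ⊆ S ∧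
      ∃ ωf ψ : E4 → Form2,
        ContDiffOn ℝ ∞ ωf (Metric.ball p r) ∧ ContDiffOn ℝ ∞ ψ (Metric.ball p r) ∧
        ∀ p' ∈ Metric.ball p r, ωf p' ≠ 0 ∧ ψ p' ≠ 0 ∧
          L₁ p' = Submodule.span ℝ {ωf p'} ∧ L₂ p' = Submodule.span ℝ {ψ p'})
    (V : Set E3) (hV : IsOpen V)
    (u : E3 → E4) (hu : ContDiffOn ℝ ∞ u V) (huS : u '' V ⊆ S)
    (huinj : Set.InjOn u V)
    (huimm : ∀ q ∈ V, Function.Injective (fderiv ℝ u q))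
    (huemb : Topology.IsEmbedding (V.restrict u)) :
    (∀ (Ut : Set E4), IsOpen Ut → Ut ⊆ S →
      ∀ ωf ψ : E4 → Form2, ContDiffOn ℝ ∞ ωf Ut → ContDiffOn ℝ ∞ ψ Ut →
      (∀ p ∈ Ut, ωf p ≠ 0 ∧ ψ p ≠ 0 ∧
        L₁ p = Submodule.span ℝ {ωf p} ∧ L₂ p = Submodule.span ℝ {ψ p}) →
      ∀ q ∈ V, u q ∈ Ut →
        -- (1) the pullbacks of `ω` and `ψ` to `M` are linearly independent at `q`:
        (∀ a b : ℝ,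
          (∀ v w, a * ωf (u q) (fderiv ℝ u q v) (fderiv ℝ u q w) +
              b * ψ (u q) (fderiv ℝ u q v) (fderiv ℝ u q w) = 0) →
          a = 0 ∧ b = 0) ∧
        -- (2) an adapted local coframing exists near `q`:
        (∃ W : Set E3, IsOpen W ∧ q ∈ W ∧ W ⊆ V ∧ u '' W ⊆ Ut ∧
          ∃ η₁ η₂ η₃ : E3 → (E3 →L[ℝ] ℝ),
            ContDiffOn ℝ ∞ η₁ W ∧ ContDiffOn ℝ ∞ η₂ W ∧ ContDiffOn ℝ ∞ η₃ W ∧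
            ∀ q' ∈ W, LinearIndependent ℝ ![η₁ q', η₂ q', η₃ q'] ∧
              (∀ v w, ωf (u q') (fderiv ℝ u q' v) (fderiv ℝ u q' w) =
                η₂ q' v * η₁ q' w - η₂ q' w * η₁ q' v) ∧
              (∀ v w, ψ (u q') (fderiv ℝ u q' v) (fderiv ℝ u q' w) =
                η₂ q' v * η₃ q' w - η₂ q' w * η₃ q' v)) ∧
        -- (3) for every adapted coframing, the annihilated line fields equal the
        -- choice-independent `P₁`, `P₂`:
        (∀ W : Set E3, q ∈ W → W ⊆ V → u '' W ⊆ Ut →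
          ∀ η₁ η₂ η₃ : E3 → (E3 →L[ℝ] ℝ),
          (∀ q' ∈ W, LinearIndependent ℝ ![η₁ q', η₂ q', η₃ q'] ∧
            (∀ v w, ωf (u q') (fderiv ℝ u q' v) (fderiv ℝ u q' w) =
              η₂ q' v * η₁ q' w - η₂ q' w * η₁ q' v) ∧
            (∀ v w, ψ (u q') (fderiv ℝ u q' v) (fderiv ℝ u q' w) =
              η₂ q' v * η₃ q' w - η₂ q' w * η₃ q' v)) →
          ∀ q' ∈ W,
            {v | η₁ q' v = 0 ∧ η₂ q' v = 0} = Pind L₁ u q' ∧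
            {v | η₂ q' v = 0 ∧ η₃ q' v = 0} = Pind L₂ u q')) ∧
    -- (4) if `M` is nondegenerate then `(P₁, P₂)` is a path geometry on `M`:
    (Nondeg L₁ L₂ u V →
      ∀ q ∈ V,
        (∃ v : E3, v ≠ 0 ∧ Pind L₁ u q = ↑(Submodule.span ℝ {v})) ∧
        (∃ v : E3, v ≠ 0 ∧ Pind L₂ u q = ↑(Submodule.span ℝ {v})) ∧
        Pind L₁ u q ∩ Pind L₂ u q = {0}) := by
  have hindep : ∀ Ut ⊆ S, ∀ ωf ψ : E4 → Form2,
      (∀ p ∈ Ut, ωf p ≠ 0 ∧ ψ p ≠ 0 ∧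
        L₁ p = Submodule.span ℝ {ωf p} ∧ L₂ p = Submodule.span ℝ {ψ p}) →
      ∀ q ∈ V, u q ∈ Ut → ∀ a b : ℝ,
      (∀ v w, a * ωf (u q) (fderiv ℝ u q v) (fderiv ℝ u q w) +
        b * ψ (u q) (fderiv ℝ u q v) (fderiv ℝ u q w) = 0) → a = 0 ∧ b = 0 := by
    intro Ut hUt ωf ψ hsp q hq hqU
    obtain ⟨hω0, hψ0, hL₁, hL₂⟩ := hsp _ hqU
    obtain ⟨α, -, hα, hJα, hsup, hinf⟩ := hsplit _ (hUt hqU)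
    rw [hL₁, hL₂] at hsup hinf
    exact pullback_independent (𝔍 (u q)) (h𝔍 _ (hUt hqU)) (fderiv ℝ u q) (huimm q hq) α hα hJα
      hω0 hψ0 hsup hinf
  have hcoframe : ∀ Ut : Set E4, IsOpen Ut → Ut ⊆ S → ∀ ωf ψ : E4 → Form2,
      ContDiffOn ℝ ∞ ωf Ut → ContDiffOn ℝ ∞ ψ Ut →
      (∀ p ∈ Ut, ωf p ≠ 0 ∧ ψ p ≠ 0 ∧
        L₁ p = Submodule.span ℝ {ωf p} ∧ L₂ p = Submodule.span ℝ {ψ p}) →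
      ∀ q ∈ V, u q ∈ Ut →
      ∃ W : Set E3, IsOpen W ∧ q ∈ W ∧ W ⊆ V ∧ u '' W ⊆ Ut ∧
        ∃ η₁ η₂ η₃ : E3 → (E3 →L[ℝ] ℝ),
          ContDiffOn ℝ ∞ η₁ W ∧ ContDiffOn ℝ ∞ η₂ W ∧ ContDiffOn ℝ ∞ η₃ W ∧
          ∀ q' ∈ W, LinearIndependent ℝ ![η₁ q', η₂ q', η₃ q'] ∧
            (∀ v w, ωf (u q') (fderiv ℝ u q' v) (fderiv ℝ u q' w) =
              η₂ q' v * η₁ q' w - η₂ q' w * η₁ q' v) ∧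
            (∀ v w, ψ (u q') (fderiv ℝ u q' v) (fderiv ℝ u q' w) =
              η₂ q' v * η₃ q' w - η₂ q' w * η₃ q' v) := by
    intro Ut hUo hUt ωf ψ hωs hψs hsp q hq hqU
    have hWU : u '' (V ∩ u ⁻¹' Ut) ⊆ Ut := by
      rintro _ ⟨q', hq', rfl⟩
      exact hq'.2
    refine ⟨V ∩ u ⁻¹' Ut, hu.continuousOn.isOpen_inter_preimage hV hUo, ⟨hq, hqU⟩,
      Set.inter_subset_left, hWU, ?_⟩
    refine exists_adapted_coframing hV Set.inter_subset_left hu hWU hωs hψs ?_ ?_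
      fun q' hq' => hindep Ut hUt ωf ψ hsp q' hq'.1 hq'.2
    · intro p hp
      obtain ⟨α, -, hα, -, hsup, -⟩ := hsplit p (hUt hp)
      refine antisymm_of_mem_span α hα ?_
      rw [← hsup, (hsp p hp).2.2.1]
      exact Submodule.mem_sup_left (Submodule.mem_span_singleton_self _)
    · intro p hp
      obtain ⟨α, -, hα, -, hsup, -⟩ := hsplit p (hUt hp)
      refine antisymm_of_mem_span α hα ?_
      rw [← hsup, (hsp p hp).2.2.2]
      exact Submodule.mem_sup_right (Submodule.mem_span_singleton_self _)
  refine ⟨fun Ut hUo hUt ωf ψ hωs hψs hsp q hq hqU => ⟨hindep Ut hUt ωf ψ hsp q hq hqU,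
    hcoframe Ut hUo hUt ωf ψ hωs hψs hsp q hq hqU, ?_⟩, fun hnd q hq => ?_⟩
  · intro W _ _ hWU η₁ η₂ η₃ hη q' hq'
    obtain ⟨hli, hω, hψ⟩ := hη q' hq'
    obtain ⟨-, -, hL₁, hL₂⟩ := hsp (u q') (hWU ⟨q', hq', rfl⟩)
    exact setOf_eq_Pind_of_adapted hL₁ hL₂ hli hω hψ
  · obtain ⟨r, hr, -, X, Y, -, -, hXY⟩ := hnd q hq
    obtain ⟨hX, hY, hP₁, hP₂, -⟩ := hXY q (Metric.mem_ball_self hr)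
    refine ⟨⟨X q, hX, hP₁⟩, ⟨Y q, hY, hP₂⟩, ?_⟩
    obtain ⟨ρ, hρ, hball, ωf, ψ, hωs, hψs, hsp⟩ := hline (u q) (huS ⟨q, hq, rfl⟩)
    have hqρ := Metric.mem_ball_self (x := u q) hρ
    obtain ⟨W, -, hqW, -, -, η₁, η₂, η₃, -, -, -, hη⟩ :=
      hcoframe _ Metric.isOpen_ball hball ωf ψ hωs hψs hsp q hq hqρ
    obtain ⟨hli, hω, hψ⟩ := hη q hqW
    obtain ⟨-, -, hL₁, hL₂⟩ := hsp (u q) hqρ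
    obtain ⟨e₁, e₂⟩ := setOf_eq_Pind_of_adapted hL₁ hL₂ hli hω hψ
    rw [← e₁, ← e₂]
    ext v
    constructor
    · rintro ⟨⟨h₁, h₂⟩, -, h₃⟩
      refine eq_zero_of_coframe_eq_zero hli fun i => ?_
      fin_cases i <;> assumption
    · rintro rfl
      simp
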